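/- arXiv:2310.13554 — 2 statements merged into one kernel-verified Lean document; each statement's English description precedes it below -/
import Mathlib

section
/- Let K ⊆ ℝ^n be a convex body containing the origin in its interior with inradius r and circumradius R (with respect to 0), and let Y be a metric space satisfying LC(Bⁿ, λ): every L-Lipschitz map from the unit sphere S^{n−1} to Y extends to a λL-Lipschitz map on the unit ball Bⁿ. Then every L-Lipschitz map f : ∂K → Y admits a (R/r)²·λ·L-Lipschitz extension F : K → Y. -/
open Metric Set

lemma aux_psi {E : Type*} [NormedAddCommGroup E] [InnerProductSpace ℝ E] (r : ℝ) (hr : 0 < r)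
    (x y : E) : dist ((max r ‖x‖)⁻¹ • x) ((max r ‖y‖)⁻¹ • y) ≤ r⁻¹ * dist x y := by
  have key : ∀ z : E, 0 ≤ r * (max r ‖z‖)⁻¹ ∧ r * (max r ‖z‖)⁻¹ ≤ 1 ∧
      r * (max r ‖z‖)⁻¹ * ‖z‖ = min r ‖z‖ := by
    intro z
    have hm : 0 < max r ‖z‖ := lt_max_of_lt_left hr
    refine ⟨by positivity, ?_, ?_⟩
    · rw [← div_eq_mul_inv, div_le_one hm]; exact le_max_left _ _
    · have := min_mul_max r ‖z‖
      field_simp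
      linarith
  obtain ⟨k0, k1, k2⟩ := key x
  obtain ⟨l0, l1, l2⟩ := key y
  have e1 : r * dist ((max r ‖x‖)⁻¹ • x) ((max r ‖y‖)⁻¹ • y)
      = ‖(r * (max r ‖x‖)⁻¹) • x - (r * (max r ‖y‖)⁻¹) • y‖ := by
    rw [mul_smul, mul_smul, ← smul_sub, norm_smul, Real.norm_of_nonneg hr.le, dist_eq_norm]
  rw [inv_mul_eq_div, le_div_iff₀ hr, mul_comm, e1, dist_eq_norm]
  generalize r * (max r ‖x‖)⁻¹ = k at *
  generalize r * (max r ‖y‖)⁻¹ = l at *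
  apply le_of_sq_le_sq _ (norm_nonneg _)
  rw [norm_sub_sq_real, norm_sub_sq_real, norm_smul, norm_smul, Real.norm_of_nonneg k0,
    Real.norm_of_nonneg l0, inner_smul_left, inner_smul_right]
  simp only [conj_trivial]
  have hI := real_inner_le_norm x y
  have hkl : k * l ≤ 1 := mul_le_one₀ k1 l0 l1
  have h1 : (k * ‖x‖ - l * ‖y‖) ^ 2 ≤ (‖x‖ - ‖y‖) ^ 2 := by
    rw [k2, l2]
    apply sq_le_sq.2
    have := abs_min_sub_min_le_max r ‖x‖ r ‖y‖
    simpa using this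
  nlinarith [mul_le_mul_of_nonneg_left hI (sub_nonneg.2 hkl)]

lemma aux_alg {E : Type*} [NormedAddCommGroup E] [InnerProductSpace ℝ E] (r R s t : ℝ) (u v : E)
    (hu : ‖u‖ = 1) (hv : ‖v‖ = 1) (hr : 0 < r) (hrt : r ≤ t) (hts : t ≤ s) (hsR : s ≤ R)
    (H : ∀ β : ℝ, 0 ≤ β → β ≤ 1 → r * (1 - β) ≤ ‖t • v - β • s • u‖) :
    dist (s • u) (t • v) ≤ R ^ 2 / r * dist u v := by
  have hR : 0 < R := by linarith
  have ht : 0 < t := by linarith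
  have hs : 0 < s := by linarith
  set c := inner ℝ u v with hc
  have hc1 : c ≤ 1 := by simpa [hu, hv] using real_inner_le_norm u v
  have hD : dist (s • u) (t • v) ^ 2 = s ^ 2 + t ^ 2 - 2 * s * t * c := by
    rw [dist_eq_norm, norm_sub_sq_real, norm_smul, norm_smul, inner_smul_left, inner_smul_right,
      hu, hv, Real.norm_of_nonneg hs.le, Real.norm_of_nonneg ht.le]
    simp only [conj_trivial]; ring
  have hC : dist u v ^ 2 = 2 - 2 * c := by
    rw [dist_eq_norm, norm_sub_sq_real, hu, hv]; ring
  apply le_of_sq_le_sq _ (by positivity)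
  rw [mul_pow, hC, hD, div_pow, div_mul_eq_mul_div, le_div_iff₀ (by positivity)]
  have hc1' : 0 ≤ 2 - 2 * c := by linarith
  rcases lt_or_ge (s * c) t with h | h
  · have h1 : s ^ 2 + t ^ 2 - 2 * s * t * c ≤ s ^ 2 * (2 - 2 * c) := by
      nlinarith [mul_nonneg (sub_nonneg.2 hts) (by linarith : 0 ≤ s + t - 2 * (s * c))]
    have h2 : s ^ 2 * r ^ 2 ≤ (R ^ 2) ^ 2 := by
      calc s ^ 2 * r ^ 2 ≤ R ^ 2 * R ^ 2 := by gcongr; linarith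
        _ = _ := by ring
    calc _ ≤ s ^ 2 * (2 - 2 * c) * r ^ 2 := by gcongr
      _ = s ^ 2 * r ^ 2 * (2 - 2 * c) := by ring
      _ ≤ _ := by gcongr
  · have hc0 : 0 < c := by
      by_contra hcon
      nlinarith
    have h2 : (s * t) ^ 2 ≤ (R ^ 2) ^ 2 := by
      have : s * t ≤ R ^ 2 := by nlinarith
      gcongr
    have h3 : (s ^ 2 + t ^ 2 - 2 * s * t * c) * r ^ 2 ≤ (s * t) ^ 2 * (1 - c ^ 2) := by
      set D := s ^ 2 + t ^ 2 - 2 * s * t * c with hDD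
      have hD0 : 0 ≤ D := by rw [← hD]; positivity
      set P := s ^ 2 - s * t * c with hP
      have hPD : D ≤ P := by nlinarith
      have hid : s ^ 2 * D - P ^ 2 = (s * t) ^ 2 * (1 - c ^ 2) := by rw [hDD, hP]; ring
      rw [← hid]
      rcases hD0.eq_or_lt with h0 | hpos
      · rw [← h0] at hid ⊢
        have : 0 ≤ (s * t) ^ 2 * (1 - c ^ 2) := by
          have : 0 ≤ 1 - c ^ 2 := by nlinarith
          positivity
        linarith
      have hPp : 0 < P := by linarith
      have hq0 : 0 < D / P := by positivity
      have hq1 : D / P ≤ 1 := (div_le_one hPp).2 hPD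
      have hH := H (1 - D / P) (by linarith) (by linarith)
      have hsq := pow_le_pow_left₀ (by rw [sub_sub_cancel]; positivity) hH 2
      rw [norm_sub_sq_real, smul_smul, norm_smul, norm_smul, inner_smul_left, inner_smul_right,
        hu, hv, real_inner_comm, ← hc, Real.norm_of_nonneg ht.le,
        Real.norm_of_nonneg (mul_nonneg (by linarith : 0 ≤ 1 - D / P) hs.le)] at hsq
      simp only [conj_trivial] at hsq
      have e : (t * 1) ^ 2 - 2 * (t * ((1 - D / P) * s * c)) + ((1 - D / P) * s * 1) ^ 2
          = D - 2 * (D / P) * P + (D / P) ^ 2 * s ^ 2 := by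
        generalize D / P = q
        rw [hDD, hP]; ring
      rw [e] at hsq
      have e2 : D / P * P = D := div_mul_cancel₀ _ hPp.ne'
      generalize D / P = q at *
      have : q ^ 2 * (D * r ^ 2) ≤ q ^ 2 * (s ^ 2 * D - P ^ 2) := by
        have e3 : q ^ 2 * (s ^ 2 * D - P ^ 2) = D * (q ^ 2 * s ^ 2 - D) := by
          rw [mul_sub, ← mul_pow, e2]; ring
        rw [e3]
        nlinarith
      exact le_of_mul_le_mul_left this (by positivity)
    calc _ ≤ (s * t) ^ 2 * (1 - c ^ 2) := h3
      _ ≤ (s * t) ^ 2 * (2 - 2 * c) := mul_le_mul_of_nonneg_left (by nlinarith [sq_nonneg (1 - c)]) (sq_nonneg _)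
      _ ≤ _ := by gcongr


/-- Transfer of the Lipschitz extension property `LC(Bⁿ, λ)` from the unit ball to a
convex body `K` with inradius `r` and circumradius `R`: every `L`-Lipschitz map
`∂K → Y` admits a `(R/r)²·λ·L`-Lipschitz extension `K → Y`. -/
theorem convex_body_lipschitz_extension (n : ℕ)
    {Y : Type*} [MetricSpace Y]
    (K : Set (EuclideanSpace ℝ (Fin n)))
    (hconv : Convex ℝ K) (hcomp : IsCompact K) (h0 : 0 ∈ interior K)
    (r R : ℝ) (hr0 : 0 < r)
    (hrmin : ∀ x ∈ frontier K, r ≤ ‖x‖)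
    (hRmax : ∀ x ∈ frontier K, ‖x‖ ≤ R)
    (lam : ℝ) (hlam : 0 ≤ lam)
    (hLC : ∀ L' : ℝ, 0 ≤ L' → ∀ g : EuclideanSpace ℝ (Fin n) → Y,
      (∀ u ∈ sphere (0 : EuclideanSpace ℝ (Fin n)) 1, ∀ v ∈ sphere (0 : EuclideanSpace ℝ (Fin n)) 1,
        dist (g u) (g v) ≤ L' * dist u v) →
      ∃ G : EuclideanSpace ℝ (Fin n) → Y,
        (∀ u ∈ closedBall (0 : EuclideanSpace ℝ (Fin n)) 1,
          ∀ v ∈ closedBall (0 : EuclideanSpace ℝ (Fin n)) 1,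
            dist (G u) (G v) ≤ lam * L' * dist u v) ∧
        ∀ u ∈ sphere (0 : EuclideanSpace ℝ (Fin n)) 1, G u = g u)
    (L : ℝ) (hL : 0 ≤ L)
    (f : EuclideanSpace ℝ (Fin n) → Y)
    (hf : ∀ x ∈ frontier K, ∀ y ∈ frontier K, dist (f x) (f y) ≤ L * dist x y) :
    ∃ F : EuclideanSpace ℝ (Fin n) → Y,
      (∀ x ∈ K, ∀ y ∈ K, dist (F x) (F y) ≤ (R / r) ^ 2 * lam * L * dist x y) ∧
      ∀ x ∈ frontier K, F x = f x := by
  have hn : K ∈ nhds (0 : EuclideanSpace ℝ (Fin n)) := mem_interior_iff_mem_nhds.1 h0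
  have habs : Absorbent ℝ K := absorbent_nhds_zero hn
  have hbdd : Bornology.IsVonNBounded ℝ K :=
    (NormedSpace.isVonNBounded_iff ℝ).2 hcomp.isBounded
  have hfr : ∀ x, gauge K x = 1 ↔ x ∈ frontier K := fun x =>
    gauge_eq_one_iff_mem_frontier hconv hn
  have hpos : ∀ x, x ≠ 0 → 0 < gauge K x := fun x hx => (gauge_pos habs hbdd).2 hx
  have hmem : ∀ x, x ≠ 0 → (gauge K x)⁻¹ • x ∈ frontier K := by
    intro x hx
    rw [← hfr, gauge_smul_of_nonneg (inv_nonneg.2 (hpos x hx).le), smul_eq_mul,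
      inv_mul_cancel₀ (hpos x hx).ne']
  have hle : ∀ x, r * gauge K x ≤ ‖x‖ := by
    intro x
    rcases eq_or_ne x 0 with rfl | hx
    · simp
    have h1 := hrmin _ (hmem x hx)
    have hp := hpos x hx
    rw [norm_smul, norm_inv, Real.norm_of_nonneg hp.le, inv_mul_eq_div, le_div_iff₀ hp] at h1
    exact h1
  have hnz : ∀ u ∈ sphere (0 : EuclideanSpace ℝ (Fin n)) 1, ‖u‖ = 1 ∧ u ≠ 0 := by
    intro u hu
    have h1 : ‖u‖ = 1 := by simpa using hu
    exact ⟨h1, by rintro rfl; simp at h1⟩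
  have hst : ∀ u ∈ sphere (0 : EuclideanSpace ℝ (Fin n)) 1,
      r ≤ (gauge K u)⁻¹ ∧ (gauge K u)⁻¹ ≤ R := by
    intro u hu
    obtain ⟨h1, h2⟩ := hnz u hu
    have a := hrmin _ (hmem u h2)
    have b := hRmax _ (hmem u h2)
    rw [norm_smul, norm_inv, Real.norm_of_nonneg (hpos u h2).le, h1, mul_one] at a b
    exact ⟨a, b⟩
  have hwl : ∀ u ∈ sphere (0 : EuclideanSpace ℝ (Fin n)) 1,
      ∀ v ∈ sphere (0 : EuclideanSpace ℝ (Fin n)) 1, (gauge K v)⁻¹ ≤ (gauge K u)⁻¹ →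
      dist ((gauge K u)⁻¹ • u) ((gauge K v)⁻¹ • v) ≤ R ^ 2 / r * dist u v := by
    intro u hu v hv huv
    refine aux_alg r R _ _ u v (hnz u hu).1 (hnz v hv).1 hr0 (hst v hv).1 huv (hst u hu).2 ?_
    intro β hβ0 hβ1
    refine le_trans (mul_le_mul_of_nonneg_left ?_ hr0.le) (hle _)
    have hx := (hfr _).2 (hmem u (hnz u hu).2)
    have hy := (hfr _).2 (hmem v (hnz v hv).2)
    generalize (gauge K u)⁻¹ • u = x at *
    generalize (gauge K v)⁻¹ • v = y at *
    have h1 := gauge_add_le hconv habs (y - β • x) (β • x)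
    rw [sub_add_cancel, gauge_smul_of_nonneg hβ0, hx, hy, smul_eq_mul] at h1
    linarith
  have hw : ∀ u ∈ sphere (0 : EuclideanSpace ℝ (Fin n)) 1,
      ∀ v ∈ sphere (0 : EuclideanSpace ℝ (Fin n)) 1,
      dist ((gauge K u)⁻¹ • u) ((gauge K v)⁻¹ • v) ≤ R ^ 2 / r * dist u v := by
    intro u hu v hv
    rcases le_total (gauge K v)⁻¹ (gauge K u)⁻¹ with h | h
    · exact hwl u hu v hv h
    · rw [dist_comm, dist_comm u v]
      exact hwl v hv u hu h
  obtain ⟨G, hG, hGg⟩ := hLC (L * (R ^ 2 / r)) (by positivity)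
    (fun u => f ((gauge K u)⁻¹ • u)) (by
      intro u hu v hv
      refine (hf _ (hmem u (hnz u hu).2) _ (hmem v (hnz v hv).2)).trans ?_
      rw [mul_assoc]
      exact mul_le_mul_of_nonneg_left (hw u hu v hv) hL)
  have hball : ∀ x : EuclideanSpace ℝ (Fin n),
      (max r ‖x‖)⁻¹ • x ∈ closedBall (0 : EuclideanSpace ℝ (Fin n)) 1 := by
    intro x
    have hm : 0 < max r ‖x‖ := lt_max_of_lt_left hr0
    rw [mem_closedBall_zero_iff, norm_smul, norm_inv, Real.norm_of_nonneg hm.le,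
      inv_mul_eq_div, div_le_one hm]
    exact le_max_right _ _
  refine ⟨fun x => G ((max r ‖x‖)⁻¹ • x), ?_, ?_⟩
  · intro x _ y _
    refine (hG _ (hball x) _ (hball y)).trans ?_
    calc _ ≤ lam * (L * (R ^ 2 / r)) * (r⁻¹ * dist x y) := by
          gcongr
          exact aux_psi r hr0 x y
      _ = _ := by field_simp
  · intro x hx
    have hrx := hrmin x hx
    have hxp : 0 < ‖x‖ := by linarith
    have hs : ‖x‖⁻¹ • x ∈ sphere (0 : EuclideanSpace ℝ (Fin n)) 1 := by
      rw [mem_sphere_zero_iff_norm, norm_smul, norm_inv, norm_norm, inv_mul_cancel₀ hxp.ne']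
    simp only [max_eq_right hrx]
    rw [hGg _ hs]
    rw [gauge_smul_of_nonneg (inv_nonneg.2 hxp.le), (hfr x).2 hx, smul_eq_mul, mul_one, inv_inv,
      smul_smul, mul_inv_cancel₀ hxp.ne', one_smul]
end

section
/- Let Y be a metric space satisfying LC(n−1, λ) for some n ≥ 1, meaning every L-Lipschitz map S^m → Y (0 ≤ m ≤ n−1) extends to a λL-Lipschitz map B^{m+1} → Y. Then every L-Lipschitz map f : ∂Δⁿ → Y (where Δⁿ is the standard Euclidean n-simplex with induced Euclidean metric and ∂Δⁿ its simplicial boundary) admits an n²λL-Lipschitz extension F : Δⁿ → Y. -/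
open Metric Set Finset

lemma aux_key {E : Type*} [NormedAddCommGroup E] [InnerProductSpace ℝ E] (r R : ℝ) (hr : 0 < r)
    (x y : E) (hy : r ≤ ‖y‖) (hxy : ‖y‖ ≤ ‖x‖) (hx : ‖x‖ ≤ R)
    (h : ∀ t : ℝ, 0 ≤ t → r ≤ ‖y + t • (y - x)‖) :
    ‖x - y‖ ≤ R ^ 2 / r * ‖(‖x‖⁻¹ • x) - (‖y‖⁻¹ • y)‖ := by
  set a := ‖x‖ with ha
  set b := ‖y‖ with hb
  set c : ℝ := inner ℝ x y with hc
  have hb0 : 0 < b := by linarith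
  have ha0 : 0 < a := by linarith
  have hR0 : 0 < R := by linarith
  have hcab : c ≤ a * b := real_inner_le_norm x y
  have h1 : ‖x - y‖ ^ 2 = a ^ 2 - 2 * c + b ^ 2 := norm_sub_sq_real x y
  have h2 : ‖(a⁻¹ • x) - (b⁻¹ • y)‖ ^ 2 = 2 - 2 * (c / (a * b)) := by
    rw [norm_sub_sq_real, norm_smul, norm_smul, real_inner_smul_left, real_inner_smul_right]
    rw [← ha, ← hb, ← hc, Real.norm_of_nonneg (by positivity), Real.norm_of_nonneg (by positivity)]
    field_simp
    ring
  have hD : 0 ≤ 2 - 2 * (c / (a * b)) := by rw [← h2]; positivity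
  refine abs_le_of_sq_le_sq' ?_ (by positivity) |>.2
  rw [mul_pow, h1, h2]
  have hK : R ≤ R ^ 2 / r := by
    rw [le_div_iff₀ hr]; nlinarith
  by_cases hcase : c ≤ b ^ 2
  · have h3 : a ^ 2 - 2 * c + b ^ 2 ≤ a ^ 2 * (2 - 2 * (c / (a * b))) := by
      have e : a ^ 2 * (2 - 2 * (c / (a * b))) = 2 * a ^ 2 - 2 * a * (c / b) := by
        field_simp
      have e2 : c = b * (c / b) := by field_simp
      have e3 : c / b ≤ b := by rw [div_le_iff₀ hb0]; nlinarith
      rw [e]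
      set d := c / b
      rw [e2]
      nlinarith [mul_nonneg (sub_nonneg.2 hxy) (sub_nonneg.2 e3), mul_nonneg (sub_nonneg.2 hxy) (sub_nonneg.2 hxy)]
    refine h3.trans ?_
    gcongr
    linarith
  · push Not at hcase
    have hpos : 0 < ‖x - y‖ ^ 2 := by rw [h1]; nlinarith [sq_nonneg (a - b)]
    have hN : 0 < a ^ 2 - 2 * c + b ^ 2 := h1 ▸ hpos
    set N := a ^ 2 - 2 * c + b ^ 2 with hNdef
    have h4 := h ((c - b ^ 2) / N) (div_nonneg (by linarith) hN.le)
    have h5 : ‖y + ((c - b ^ 2) / N) • (y - x)‖ ^ 2 = b ^ 2 - (c - b ^ 2) ^ 2 / N := by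
      rw [norm_add_sq_real, norm_smul, mul_pow, norm_sub_rev y x, h1, real_inner_smul_right,
        inner_sub_right, real_inner_self_eq_norm_sq, real_inner_comm, ← hb, ← hc,
        Real.norm_eq_abs, sq_abs]
      field_simp
      ring
    have h6 : r ^ 2 ≤ b ^ 2 - (c - b ^ 2) ^ 2 / N := by
      rw [← h5]; gcongr
    have h7 : r ^ 2 * N ≤ a ^ 2 * b ^ 2 - c ^ 2 := by
      have := mul_le_mul_of_nonneg_right h6 hN.le
      have e : (b ^ 2 - (c - b ^ 2) ^ 2 / N) * N = b ^ 2 * N - (c - b ^ 2) ^ 2 := by field_simp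
      rw [e] at this
      refine this.trans (le_of_eq ?_)
      rw [hNdef]; ring
    have h8 : r ^ 2 * N ≤ R ^ 4 * (2 - 2 * (c / (a * b))) := by
      calc r ^ 2 * N ≤ a ^ 2 * b ^ 2 - c ^ 2 := h7
        _ ≤ (a * b - c) * (2 * (a * b)) := by nlinarith
        _ = (a * b) ^ 2 * (2 - 2 * (c / (a * b))) := by field_simp
        _ ≤ (R * R) ^ 2 * (2 - 2 * (c / (a * b))) := by gcongr; linarith
        _ = _ := by ring
    rw [div_pow, div_mul_eq_mul_div, le_div_iff₀ (by positivity)]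
    linarith

/-- Nearest point projection to the unit ball. -/
noncomputable def auxP {E : Type*} [NormedAddCommGroup E] [InnerProductSpace ℝ E] (u : E) : E :=
  (max 1 ‖u‖)⁻¹ • u

lemma auxP_norm {E : Type*} [NormedAddCommGroup E] [InnerProductSpace ℝ E] (u : E) :
    ‖auxP u‖ ≤ 1 := by
  unfold auxP
  have : 0 < max 1 ‖u‖ := lt_max_of_lt_left one_pos
  rw [norm_smul, Real.norm_of_nonneg (by positivity), inv_mul_le_iff₀ this]
  simp

lemma auxP_var {E : Type*} [NormedAddCommGroup E] [InnerProductSpace ℝ E] (u z : E)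
    (hz : ‖z‖ ≤ 1) : inner ℝ (u - auxP u) (z - auxP u) ≤ 0 := by
  unfold auxP
  rcases le_total ‖u‖ 1 with h | h
  · rw [max_eq_left h]; simp
  · rw [max_eq_right h]
    have h0 : 0 < ‖u‖ := by linarith
    have e : u - ‖u‖⁻¹ • u = (1 - ‖u‖⁻¹) • u := by module
    rw [e, real_inner_smul_left, inner_sub_right, real_inner_smul_right, real_inner_self_eq_norm_sq]
    have h1 : ‖u‖⁻¹ ≤ 1 := inv_le_one_of_one_le₀ h
    have h2 : ‖u‖⁻¹ * ‖u‖ ^ 2 = ‖u‖ := by field_simp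
    rw [h2]
    have h3 := real_inner_le_norm u z
    apply mul_nonpos_of_nonneg_of_nonpos <;> nlinarith

lemma auxP_lip {E : Type*} [NormedAddCommGroup E] [InnerProductSpace ℝ E] (u v : E) :
    ‖auxP u - auxP v‖ ≤ ‖u - v‖ := by
  have h1 := auxP_var u (auxP v) (auxP_norm v)
  have h2 := auxP_var v (auxP u) (auxP_norm u)
  have h3 := real_inner_le_norm (u - v) (auxP u - auxP v)
  have h4 := real_inner_self_eq_norm_sq (auxP u - auxP v)
  have h5 : ‖auxP u - auxP v‖ ^ 2 ≤ ‖u - v‖ * ‖auxP u - auxP v‖ := by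
    rw [← h4]
    rw [← h4] at *
    simp only [inner_sub_left, inner_sub_right] at *
    linarith [real_inner_comm (auxP u) (auxP v)]
  rcases (norm_nonneg (auxP u - auxP v)).eq_or_lt with h | h
  · rw [← h]; positivity
  · nlinarith

lemma aux_inrad (n : ℕ) (hn : 1 ≤ n) (w : EuclideanSpace ℝ (Fin (n + 1))) (hw : ∑ i, w i = 0)
    (i : Fin (n + 1)) (hi : w i ≤ -(1 / ((n : ℝ) + 1))) :
    1 / ((n : ℝ) * (n + 1)) ≤ ‖w‖ ^ 2 := by
  rw [EuclideanSpace.real_norm_sq_eq]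
  have hn' : (1 : ℝ) ≤ n := by exact_mod_cast hn
  have h1 := Finset.add_sum_erase Finset.univ (fun j => w j) (Finset.mem_univ i)
  have h2 := Finset.add_sum_erase Finset.univ (fun j => w j ^ 2) (Finset.mem_univ i)
  have h3 := sq_sum_le_card_mul_sum_sq (s := Finset.univ.erase i) (f := fun j => w j)
  rw [Finset.card_erase_of_mem (Finset.mem_univ i)] at h3
  simp only [Finset.card_univ, Fintype.card_fin, Nat.add_sub_cancel] at h3 h1 h2
  rw [← h2]
  have h4 : ∑ j ∈ Finset.univ.erase i, w j = - w i := by linarith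
  rw [h4] at h3
  have h5 : (1 / ((n : ℝ) + 1)) ^ 2 ≤ (w i) ^ 2 := by
    have : 0 < 1 / ((n : ℝ) + 1) := by positivity
    nlinarith
  have h6 : (1 / ((n : ℝ) + 1)) ^ 2 * ((n + 1) / n) ≤ (w i) ^ 2 * ((n + 1) / n) := by gcongr
  have h7 : (1 / ((n : ℝ) + 1)) ^ 2 * ((n + 1) / n) = 1 / ((n : ℝ) * (n + 1)) := by field_simp
  have h8 : (w i) ^ 2 * ((n + 1) / n) = w i ^ 2 + (- w i) ^ 2 / n := by field_simp
  have h9 : (- w i) ^ 2 / n ≤ ∑ j ∈ Finset.univ.erase i, w j ^ 2 := by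
    rw [div_le_iff₀ (by positivity)]; linarith
  linarith

lemma aux_iso (n : ℕ) : ∃ j : EuclideanSpace ℝ (Fin n) →ₗᵢ[ℝ] EuclideanSpace ℝ (Fin (n + 1)),
    ∀ w, (∃ z, j z = w) ↔ ∑ i, w i = 0 := by
  let v : EuclideanSpace ℝ (Fin (n + 1)) := WithLp.toLp 2 (fun _ => 1)
  have hv : v ≠ 0 := by
    intro h
    have := congrArg (fun x : EuclideanSpace ℝ (Fin (n + 1)) => x 0) h
    simp [v] at this
  haveI : Fact (Module.finrank ℝ (EuclideanSpace ℝ (Fin (n + 1))) = n + 1) := ⟨by simp⟩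
  let B := OrthonormalBasis.fromOrthogonalSpanSingleton (𝕜 := ℝ) n hv
  refine ⟨(Submodule.subtypeₗᵢ _).comp B.repr.symm.toLinearIsometry, fun w => ?_⟩
  have hm : w ∈ (Submodule.span ℝ {v})ᗮ ↔ ∑ i, w i = 0 := by
    rw [Submodule.mem_orthogonal_singleton_iff_inner_right]
    simp [v, PiLp.inner_apply]
  rw [← hm]
  constructor
  · rintro ⟨z, rfl⟩
    exact (B.repr.symm z).2
  · intro h
    exact ⟨B.repr ⟨w, h⟩, by simp⟩

/-- If `Y` satisfies `LC(n−1, λ)` (every `L`-Lipschitz map `S^m → Y`, `0 ≤ m ≤ n−1`,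
extends to a `λL`-Lipschitz map `B^{m+1} → Y`), then every `L`-Lipschitz map from the
boundary of the standard Euclidean `n`-simplex to `Y` admits an `n²λL`-Lipschitz
extension to the whole simplex. -/
theorem simplex_boundary_lipschitz_extension (n : ℕ) (hn : 1 ≤ n)
    {Y : Type*} [MetricSpace Y]
    (lam : ℝ) (hlam : 0 ≤ lam)
    (hLC : ∀ m : ℕ, m + 1 ≤ n → ∀ L' : ℝ, 0 ≤ L' →
      ∀ g : EuclideanSpace ℝ (Fin (m + 1)) → Y,
      (∀ u ∈ sphere (0 : EuclideanSpace ℝ (Fin (m + 1))) 1,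
        ∀ v ∈ sphere (0 : EuclideanSpace ℝ (Fin (m + 1))) 1,
          dist (g u) (g v) ≤ L' * dist u v) →
      ∃ G : EuclideanSpace ℝ (Fin (m + 1)) → Y,
        (∀ u ∈ closedBall (0 : EuclideanSpace ℝ (Fin (m + 1))) 1,
          ∀ v ∈ closedBall (0 : EuclideanSpace ℝ (Fin (m + 1))) 1,
            dist (G u) (G v) ≤ lam * L' * dist u v) ∧
        ∀ u ∈ sphere (0 : EuclideanSpace ℝ (Fin (m + 1))) 1, G u = g u)
    (Δ bdry : Set (EuclideanSpace ℝ (Fin (n + 1))))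
    (hΔ : Δ = {x | (∀ i, 0 ≤ x i) ∧ ∑ i, x i = 1})
    (hbdry : bdry = {x ∈ Δ | ∃ i, x i = 0})
    (L : ℝ) (hL : 0 ≤ L)
    (f : EuclideanSpace ℝ (Fin (n + 1)) → Y)
    (hf : ∀ x ∈ bdry, ∀ y ∈ bdry, dist (f x) (f y) ≤ L * dist x y) :
    ∃ F : EuclideanSpace ℝ (Fin (n + 1)) → Y,
      (∀ x ∈ Δ, ∀ y ∈ Δ, dist (F x) (F y) ≤ (n : ℝ) ^ 2 * lam * L * dist x y) ∧
      ∀ x ∈ bdry, F x = f x := by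
  have hn' : (1 : ℝ) ≤ n := by exact_mod_cast hn
  obtain ⟨j, hj⟩ := aux_iso n
  set b : EuclideanSpace ℝ (Fin (n + 1)) := WithLp.toLp 2 (fun _ => 1 / ((n : ℝ) + 1)) with hb
  have hbi : ∀ i, b i = 1 / ((n : ℝ) + 1) := fun i => rfl
  have hbs : ∑ i, b i = 1 := by
    simp only [hbi, Finset.sum_const, Finset.card_univ, Fintype.card_fin, nsmul_eq_mul]
    push_cast; field_simp
  set r : ℝ := √(1 / ((n : ℝ) * (n + 1))) with hr
  set R : ℝ := √((n : ℝ) / (n + 1)) with hR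
  have hr2 : r ^ 2 = 1 / ((n : ℝ) * (n + 1)) := Real.sq_sqrt (by positivity)
  have hR2 : R ^ 2 = (n : ℝ) / (n + 1) := Real.sq_sqrt (by positivity)
  have hr0 : 0 < r := Real.sqrt_pos.2 (by positivity)
  have hR0 : 0 < R := Real.sqrt_pos.2 (by positivity)
  have hbΔ : ∀ x ∈ bdry, x ∈ Δ := by intro x hx; rw [hbdry] at hx; exact hx.1
  -- coordinates
  have hT : ∀ x, ∃ w, x ∈ Δ → j w = x - b := by
    intro x
    by_cases hx : x ∈ Δ
    · have : ∑ i, (x - b) i = 0 := by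
        rw [hΔ] at hx
        simp only [PiLp.sub_apply, Finset.sum_sub_distrib, hbs, hx.2, sub_self]
      obtain ⟨w, hw⟩ := (hj _).2 this
      exact ⟨w, fun _ => hw⟩
    · exact ⟨0, fun h => absurd h hx⟩
  choose T hT using hT
  have hTd : ∀ x ∈ Δ, ∀ y ∈ Δ, ‖T x - T y‖ = dist x y := by
    intro x hx y hy
    rw [← j.norm_map, map_sub, hT x hx, hT y hy, dist_eq_norm]; congr 1; abel
  have hTR : ∀ x ∈ Δ, ‖T x‖ ≤ R := by
    intro x hx
    apply Real.le_sqrt_of_sq_le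
    rw [← j.norm_map, hT x hx, EuclideanSpace.real_norm_sq_eq]
    rw [hΔ] at hx
    have e : ∀ i, (x - b) i ^ 2 ≤ x i - 2 * (1 / ((n : ℝ) + 1)) * x i + (1 / ((n : ℝ) + 1)) * b i := by
      intro i
      have h1 : x i ≤ 1 := by
        rw [← hx.2]; exact Finset.single_le_sum (fun i _ => hx.1 i) (Finset.mem_univ i)
      have h0 := hx.1 i
      simp only [PiLp.sub_apply, hbi]
      nlinarith
    refine (Finset.sum_le_sum fun i _ => e i).trans (le_of_eq ?_)
    rw [Finset.sum_add_distrib, Finset.sum_sub_distrib, ← Finset.mul_sum, ← Finset.mul_sum, hx.2, hbs]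
    field_simp; ring
  have hin : ∀ x ∈ Δ, ∀ y ∈ bdry, ∀ t : ℝ, 0 ≤ t → r ≤ ‖T y + t • (T y - T x)‖ := by
    intro x hx y hy t ht
    have hyΔ := hbΔ y hy
    have hz : ∑ i, (j (T y + t • (T y - T x))) i = 0 := (hj _).1 ⟨_, rfl⟩
    rw [hbdry] at hy
    obtain ⟨_, i, hi⟩ := hy
    rw [← j.norm_map]
    apply Real.sqrt_le_iff.2 ⟨norm_nonneg _, ?_⟩
    refine aux_inrad n hn _ hz i ?_
    rw [map_add, map_smul, map_sub, hT x hx, hT y hyΔ]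
    simp only [PiLp.add_apply, PiLp.smul_apply, PiLp.sub_apply, hbi, hi, smul_eq_mul]
    rw [hΔ] at hx
    nlinarith [mul_nonneg ht (hx.1 i)]
  have hTr : ∀ y ∈ bdry, r ≤ ‖T y‖ := by
    intro y hy
    simpa using hin y (hbΔ y hy) y hy 0 le_rfl
  have hkey : ∀ x ∈ bdry, ∀ y ∈ bdry,
      dist x y ≤ R ^ 2 / r * ‖(‖T x‖⁻¹ • T x) - (‖T y‖⁻¹ • T y)‖ := by
    intro x hx y hy
    rcases le_total ‖T y‖ ‖T x‖ with h | h
    · rw [← hTd x (hbΔ x hx) y (hbΔ y hy)]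
      exact aux_key r R hr0 _ _ (hTr y hy) h (hTR x (hbΔ x hx)) (hin x (hbΔ x hx) y hy)
    · rw [dist_comm, ← hTd y (hbΔ y hy) x (hbΔ x hx), norm_sub_rev (‖T x‖⁻¹ • T x)]
      exact aux_key r R hr0 _ _ (hTr x hx) h (hTR y (hbΔ y hy)) (hin y (hbΔ y hy) x hx)
  have hψ : ∀ u : EuclideanSpace ℝ (Fin n), ∃ x, ‖u‖ = 1 → x ∈ bdry ∧ ‖T x‖⁻¹ • T x = u := by
    intro u
    by_cases hu : ‖u‖ = 1
    swap
    · exact ⟨0, fun h => absurd h hu⟩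
    have hs : ∑ i, (j u) i = 0 := (hj _).1 ⟨_, rfl⟩
    obtain ⟨i, -, hi⟩ := Finset.exists_min_image Finset.univ (fun i => (j u) i) Finset.univ_nonempty
    have hneg : (j u) i < 0 := by
      by_contra hcon
      push Not at hcon
      have h0 : ∀ k, 0 ≤ (j u) k := fun k => hcon.trans (hi k (Finset.mem_univ k))
      have h1 := (Finset.sum_eq_zero_iff_of_nonneg (fun k _ => h0 k)).1 hs
      have h2 : j u = 0 := by ext k; simpa using h1 k (Finset.mem_univ k)
      have h3 := j.norm_map u
      rw [h2, hu] at h3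
      simp at h3
    set s := - (j u) i with hsd
    have hs0 : 0 < s := by linarith
    set t : ℝ := 1 / ((n : ℝ) + 1) / s with ht
    have ht0 : 0 < t := by positivity
    have hts : t * s = 1 / ((n : ℝ) + 1) := by rw [ht]; field_simp
    have hxΔ : b + t • j u ∈ Δ := by
      rw [hΔ]
      refine ⟨fun k => ?_, ?_⟩
      · have := mul_le_mul_of_nonneg_left (hi k (Finset.mem_univ k)) ht0.le
        simp only [PiLp.add_apply, PiLp.smul_apply, hbi, smul_eq_mul]
        rw [← hts]; simp only [hsd]; linarith
      · simp only [PiLp.add_apply, PiLp.smul_apply, smul_eq_mul, Finset.sum_add_distrib, hbs,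
          ← Finset.mul_sum, hs]; simp
    refine ⟨b + t • j u, fun _ => ⟨?_, ?_⟩⟩
    · rw [hbdry]
      refine ⟨hxΔ, i, ?_⟩
      simp only [PiLp.add_apply, PiLp.smul_apply, hbi, smul_eq_mul]
      rw [← hts]; simp only [hsd]; ring
    · have e : T (b + t • j u) = t • u := by
        apply j.injective
        rw [hT _ hxΔ, map_smul]; abel
      rw [e, norm_smul, hu, Real.norm_of_nonneg ht0.le, smul_smul, mul_one, inv_mul_cancel₀ ht0.ne',
        one_smul]
  choose ψ hψ using hψ
  obtain ⟨m, rfl⟩ : ∃ m, n = m + 1 := ⟨n - 1, by omega⟩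
  obtain ⟨G, hG1, hG2⟩ := hLC m le_rfl (L * (R ^ 2 / r)) (by positivity) (fun u => f (ψ u)) (by
    intro u hu v hv
    rw [mem_sphere_zero_iff_norm] at hu hv
    obtain ⟨h1, h2⟩ := hψ u hu
    obtain ⟨h3, h4⟩ := hψ v hv
    have h5 := hkey _ h1 _ h3
    rw [h2, h4] at h5
    rw [dist_eq_norm u v, mul_assoc]
    exact (hf _ h1 _ h3).trans (mul_le_mul_of_nonneg_left h5 hL))
  have hKr : R ^ 2 / r * r⁻¹ = ((m + 1 : ℕ) : ℝ) ^ 2 := by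
    have : R ^ 2 / r * r⁻¹ = R ^ 2 / r ^ 2 := by field_simp
    rw [this, hR2, hr2]
    field_simp
  refine ⟨fun x => G (auxP (r⁻¹ • T x)), fun x hx y hy => ?_, fun x hx => ?_⟩
  · refine (hG1 _ (by simpa using auxP_norm _) _ (by simpa using auxP_norm _)).trans ?_
    have h1 := auxP_lip (r⁻¹ • T x) (r⁻¹ • T y)
    rw [← smul_sub, norm_smul, Real.norm_of_nonneg (by positivity), hTd x hx y hy] at h1
    rw [dist_eq_norm]
    calc _ ≤ lam * (L * (R ^ 2 / r)) * (r⁻¹ * dist x y) := by gcongr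
      _ = (R ^ 2 / r * r⁻¹) * lam * L * dist x y := by ring
      _ = _ := by rw [hKr]
  · have h1 := hTr x hx
    have hx0 : 0 < ‖T x‖ := by linarith
    have e : auxP (r⁻¹ • T x) = ‖T x‖⁻¹ • T x := by
      unfold auxP
      rw [norm_smul, Real.norm_of_nonneg (by positivity), max_eq_right, smul_smul]
      · congr 1; field_simp
      · rw [inv_mul_eq_div, le_div_iff₀ hr0]; linarith
    have h2 : ‖‖T x‖⁻¹ • T x‖ = 1 := by
      rw [norm_smul, norm_inv, norm_norm, inv_mul_cancel₀ hx0.ne']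
    simp only [e]
    rw [hG2 _ (by simpa using h2)]
    obtain ⟨h3, h4⟩ := hψ _ h2
    have h5 := hkey _ h3 _ hx
    rw [h4, sub_self, norm_zero, mul_zero] at h5
    rw [dist_le_zero.1 h5]
end
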